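/- arXiv:1608.04481 — 2 statements merged into one kernel-verified Lean document; each statement's English description precedes it below -/
import Mathlib

section
/- Suppose β ∈ (0,1], ∑_{k'} ‖A^(k')‖·‖B_(k')‖ > 0, and the sampling probabilities are nearly optimal: q k ≥ β·‖A^(k)‖·‖B_(k)‖ / ∑_{k'} ‖A^(k')‖·‖B_(k')‖ for every k. Then the expected squared Frobenius error of the BasicMatrixMultiplication sketch satisfies ∫ ‖A·B − CR(ω)‖_F² ∂μ ≤ (1/(β·c))·‖A‖_F²·‖B‖_F². -/
open MeasureTheory

/-- Frobenius norm of a real matrix. -/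
noncomputable def frobNorm {m p : ℕ} (M : Matrix (Fin m) (Fin p) ℝ) : ℝ :=
  Real.sqrt (∑ i, ∑ j, (M i j) ^ 2)

/-- Euclidean norm of a vector. -/
noncomputable def vecNorm {m : ℕ} (v : Fin m → ℝ) : ℝ :=
  Real.sqrt (∑ i, (v i) ^ 2)

/-- The `BasicMatrixMultiplication` sketch. -/
noncomputable def CRsketch {m n p c : ℕ} (A : Matrix (Fin m) (Fin n) ℝ)
    (B : Matrix (Fin n) (Fin p) ℝ) (q : Fin n → ℝ) (ω : Fin c → Fin n) :
    Matrix (Fin m) (Fin p) ℝ :=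
  ∑ t : Fin c, (1 / ((c : ℝ) * q (ω t))) • Matrix.vecMulVec (fun i => A i (ω t)) (B (ω t))

open ProbabilityTheory

theorem sq_vecNorm {m : ℕ} (v : Fin m → ℝ) : vecNorm v ^ 2 = ∑ i, v i ^ 2 :=
  Real.sq_sqrt (Finset.sum_nonneg fun _ _ => sq_nonneg _)

theorem vecNorm_nonneg {m : ℕ} (v : Fin m → ℝ) : 0 ≤ vecNorm v :=
  Real.sqrt_nonneg _

theorem sq_frobNorm {m p : ℕ} (M : Matrix (Fin m) (Fin p) ℝ) :
    frobNorm M ^ 2 = ∑ i, ∑ j, M i j ^ 2 :=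
  Real.sq_sqrt (Finset.sum_nonneg fun _ _ => Finset.sum_nonneg fun _ _ => sq_nonneg _)

theorem sq_frobNorm_eq_sum_sq_vecNorm_row {m p : ℕ} (M : Matrix (Fin m) (Fin p) ℝ) :
    frobNorm M ^ 2 = ∑ i, vecNorm (M i) ^ 2 := by
  simp only [sq_frobNorm, sq_vecNorm]

theorem sq_frobNorm_eq_sum_sq_vecNorm_col {m p : ℕ} (M : Matrix (Fin m) (Fin p) ℝ) :
    frobNorm M ^ 2 = ∑ j, vecNorm (fun i => M i j) ^ 2 := by
  simp only [sq_frobNorm, sq_vecNorm]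
  exact Finset.sum_comm

theorem CRsketch_apply {m n p c : ℕ} (A : Matrix (Fin m) (Fin n) ℝ)
    (B : Matrix (Fin n) (Fin p) ℝ) (q : Fin n → ℝ) (ω : Fin c → Fin n) (i : Fin m) (j : Fin p) :
    CRsketch A B q ω i j = ∑ t, A i (ω t) * B (ω t) j / (c * q (ω t)) := by
  simp only [CRsketch, Matrix.sum_apply, Matrix.smul_apply, Matrix.vecMulVec_apply, smul_eq_mul]
  exact Finset.sum_congr rfl fun t _ => by ring

theorem integral_eq_sum_mul_of_measure_singleton {κ : Type*} [Fintype κ] [MeasurableSpace κ]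
    [MeasurableSingletonClass κ] {q : κ → ℝ} (hq : ∀ k, 0 ≤ q k) (ν : Measure κ)
    [IsFiniteMeasure ν] (hν : ∀ k, ν {k} = ENNReal.ofReal (q k)) (g : κ → ℝ) :
    ∫ k, g k ∂ν = ∑ k, q k * g k := by
  rw [integral_fintype .of_finite]
  simp [measureReal_def, hν, ENNReal.toReal_ofReal (hq _)]

/-- The mean squared error of the importance-sampling estimator of a finite sum. -/
theorem integral_sq_sum_sub_importance_sampling_le {κ : Type*} [Fintype κ] [MeasurableSpace κ]
    [MeasurableSingletonClass κ] {q : κ → ℝ} (hq : ∀ k, 0 < q k) (ν : Measure κ)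
    [IsProbabilityMeasure ν] (hν : ∀ k, ν {k} = ENNReal.ofReal (q k)) {c : ℕ} (hc : 0 < c)
    (f : κ → ℝ) :
    ∫ ω : Fin c → κ, (∑ k, f k - ∑ t, f (ω t) / (c * q (ω t))) ^ 2 ∂(Measure.pi fun _ => ν) ≤
      1 / c * ∑ k, f k ^ 2 / q k := by
  have hc' : (c : ℝ) ≠ 0 := by positivity
  have hq' : ∀ k, q k ≠ 0 := fun k => (hq k).ne'
  let X : κ → ℝ := fun k => f k / (c * q k)
  have hX : MemLp X 2 ν := .of_discrete
  have hmeanX : ∫ k, X k ∂ν = (∑ k, f k) / c := by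
    rw [integral_eq_sum_mul_of_measure_singleton (fun k => (hq k).le) ν hν, Finset.sum_div]
    refine Finset.sum_congr rfl fun k _ => ?_
    have := hq' k
    simp only [X]
    field_simp
  have hmean : ∫ ω : Fin c → κ, (∑ t, fun ω : Fin c → κ => X (ω t)) ω ∂(Measure.pi fun _ => ν) =
      ∑ k, f k := by
    simp only [Finset.sum_apply]
    rw [integral_finsetSum _ fun t _ => .of_finite]
    have h (t : Fin c) : ∫ ω : Fin c → κ, X (ω t) ∂(Measure.pi fun _ => ν) = ∫ k, X k ∂ν :=
      integral_comp_eval (μ := fun _ : Fin c => ν) (i := t) .of_discrete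
    simp only [h, hmeanX, Finset.sum_const, Finset.card_univ, Fintype.card_fin, nsmul_eq_mul]
    field_simp
  calc
    _ = Var[∑ t : Fin c, fun ω : Fin c → κ => X (ω t); Measure.pi fun _ => ν] := by
      rw [variance_eq_integral Measurable.of_discrete.aemeasurable, hmean]
      refine integral_congr_ae (.of_forall fun ω => ?_)
      simp only [X, Finset.sum_apply]
      ring
    _ = ∑ _t : Fin c, Var[X; ν] := variance_sum_pi fun _ => hX
    _ ≤ ∑ _t : Fin c, ∫ k, (X ^ 2) k ∂ν :=
      Finset.sum_le_sum fun _ _ => variance_le_expectation_sq hX.aestronglyMeasurable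
    _ = 1 / c * ∑ k, f k ^ 2 / q k := by
      rw [integral_eq_sum_mul_of_measure_singleton (fun k => (hq k).le) ν hν, Finset.sum_const,
        Finset.card_univ, Fintype.card_fin, nsmul_eq_mul, Finset.mul_sum, Finset.mul_sum]
      refine Finset.sum_congr rfl fun k _ => ?_
      have := hq' k
      simp only [X, Pi.pow_apply]
      field_simp

/-- The mean squared Frobenius error of the sketch, for arbitrary positive probabilities. -/
theorem integral_sq_frobNorm_sub_CRsketch_le {m n p c : ℕ} (hc : 0 < c)
    (A : Matrix (Fin m) (Fin n) ℝ) (B : Matrix (Fin n) (Fin p) ℝ)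
    {q : Fin n → ℝ} (hq : ∀ k, 0 < q k) (ν : Measure (Fin n)) [IsProbabilityMeasure ν]
    (hν : ∀ k, ν {k} = ENNReal.ofReal (q k)) :
    ∫ ω : Fin c → Fin n, frobNorm (A * B - CRsketch A B q ω) ^ 2 ∂(Measure.pi fun _ => ν) ≤
      1 / c * ∑ k, (vecNorm (fun i => A i k) * vecNorm (B k)) ^ 2 / q k := by
  simp only [sq_frobNorm]
  rw [integral_finsetSum _ fun i _ => .of_finite]
  simp only [integral_finsetSum _ fun _ _ => Integrable.of_finite, Matrix.sub_apply,
    Matrix.mul_apply, CRsketch_apply]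
  calc
    _ ≤ ∑ i, ∑ j, 1 / (c : ℝ) * ∑ k, (A i k * B k j) ^ 2 / q k :=
      Finset.sum_le_sum fun i _ => Finset.sum_le_sum fun j _ =>
        integral_sq_sum_sub_importance_sampling_le hq ν hν hc fun k => A i k * B k j
    _ = _ := by
      simp only [← Finset.mul_sum]
      congr 1
      rw [Finset.sum_congr rfl fun i _ => Finset.sum_comm, Finset.sum_comm]
      refine Finset.sum_congr rfl fun k _ => ?_
      simp only [mul_pow, sq_vecNorm, Finset.sum_mul_sum, Finset.sum_div]

theorem sum_sq_div_le_of_near_optimal {κ : Type*} [Fintype κ] {a q : κ → ℝ} {β : ℝ}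
    (ha : ∀ k, 0 ≤ a k) (hq : ∀ k, 0 < q k) (hβ : 0 < β) (hsum : 0 < ∑ k, a k)
    (hopt : ∀ k, β * a k / ∑ k', a k' ≤ q k) :
    ∑ k, a k ^ 2 / q k ≤ 1 / β * (∑ k, a k) ^ 2 := by
  rw [sq (∑ k, a k), Finset.mul_sum, Finset.mul_sum]
  refine Finset.sum_le_sum fun k _ => ?_
  have h := (div_le_iff₀ hsum).1 (hopt k)
  have h' := mul_le_mul_of_nonneg_left h (ha k)
  rw [div_le_iff₀ (hq k), ← mul_le_mul_iff_right₀ hβ]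
  field_simp
  linarith

theorem stmt_3 {m n p c : ℕ} (hm : 0 < m) (hn : 0 < n) (hp : 0 < p) (hc : 0 < c)
    (A : Matrix (Fin m) (Fin n) ℝ) (B : Matrix (Fin n) (Fin p) ℝ)
    (q : Fin n → ℝ) (hq : ∀ k, 0 < q k) (hq1 : ∑ k, q k = 1)
    (ν : Measure (Fin n)) [IsProbabilityMeasure ν]
    (hν : ∀ k, ν {k} = ENNReal.ofReal (q k))
    (μ : Measure (Fin c → Fin n)) (hμ : μ = Measure.pi fun _ => ν)
    (β : ℝ) (hβ : β ∈ Set.Ioc (0 : ℝ) 1)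
    (hsum : 0 < ∑ k', vecNorm (fun i => A i k') * vecNorm (B k'))
    (hnearopt : ∀ k, q k ≥ β * (vecNorm (fun i => A i k) * vecNorm (B k)) /
        ∑ k', vecNorm (fun i => A i k') * vecNorm (B k')) :
    (∫ ω, frobNorm (A * B - CRsketch A B q ω) ^ 2 ∂μ) ≤
      (1 / (β * (c : ℝ))) * frobNorm A ^ 2 * frobNorm B ^ 2 := by
  have hcauchy := Finset.sum_mul_sq_le_sq_mul_sq Finset.univ
    (fun k => vecNorm fun i => A i k) (fun k => vecNorm (B k))
  rw [← sq_frobNorm_eq_sum_sq_vecNorm_col, ← sq_frobNorm_eq_sum_sq_vecNorm_row] at hcauchy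
  have hβ0 := hβ.1
  subst hμ
  calc
    _ ≤ 1 / c * ∑ k, (vecNorm (fun i => A i k) * vecNorm (B k)) ^ 2 / q k :=
      integral_sq_frobNorm_sub_CRsketch_le hc A B hq ν hν
    _ ≤ 1 / c * (1 / β * (∑ k, vecNorm (fun i => A i k) * vecNorm (B k)) ^ 2) := by
      gcongr
      exact sum_sq_div_le_of_near_optimal
        (fun k => mul_nonneg (vecNorm_nonneg _) (vecNorm_nonneg _)) hq hβ0 hsum hnearopt
    _ ≤ 1 / c * (1 / β * (frobNorm A ^ 2 * frobNorm B ^ 2)) := by gcongr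
    _ = _ := by field_simp
end

section
/- LinearTimeSVD Frobenius-norm theorem: for every D : Matrix (Fin m) (Fin n) ℝ with Matrix.rank D ≤ k, ‖A − H·Hᵀ·A‖_F² ≤ ‖A − D‖_F² + 2·√k·‖A·Aᵀ − C·Cᵀ‖_F; that is, the squared Frobenius error of projecting A onto the top-k left singular vectors of C exceeds the optimal rank-k squared error by at most 2√k·‖AAᵀ − CCᵀ‖_F. -/
open Matrix

lemma frobNorm_nonneg {m p : ℕ} (M : Matrix (Fin m) (Fin p) ℝ) : 0 ≤ frobNorm M :=
  Real.sqrt_nonneg _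

lemma frobNorm_sq {m p : ℕ} (M : Matrix (Fin m) (Fin p) ℝ) :
    frobNorm M ^ 2 = trace (M * Mᵀ) := by
  rw [frobNorm, Real.sq_sqrt (by positivity)]
  simp [trace, mul_apply, sq]

lemma trace_mul_transpose_self_nonneg {m p : ℕ} (M : Matrix (Fin m) (Fin p) ℝ) :
    0 ≤ trace (M * Mᵀ) :=
  frobNorm_sq M ▸ sq_nonneg _

/-- Squared Frobenius error of an orthogonal projection. -/
lemma frobNorm_sub_mul_sq {m p : ℕ} {P : Matrix (Fin m) (Fin m) ℝ} (hs : Pᵀ = P)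
    (hi : P * P = P) (A : Matrix (Fin m) (Fin p) ℝ) :
    frobNorm (A - P * A) ^ 2 = trace (A * Aᵀ) - trace (P * (A * Aᵀ)) := by
  have h₁ : trace (A * (Aᵀ * P)) = trace (P * (A * Aᵀ)) := by
    rw [← Matrix.mul_assoc, trace_mul_comm]
  have h₂ : trace (P * (A * (Aᵀ * P))) = trace (P * (A * Aᵀ)) := by
    rw [trace_mul_comm]
    simp only [Matrix.mul_assoc, hi]
    exact h₁
  rw [frobNorm_sq, transpose_sub, transpose_mul, hs]
  simp only [Matrix.sub_mul, Matrix.mul_sub, trace_sub, Matrix.mul_assoc, h₁, h₂]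
  ring

lemma trace_proj_mul_nonneg {m p : ℕ} {P : Matrix (Fin m) (Fin m) ℝ} (hs : Pᵀ = P)
    (hi : P * P = P) (A : Matrix (Fin m) (Fin p) ℝ) : 0 ≤ trace (P * (A * Aᵀ)) := by
  have h : trace (P * (A * Aᵀ)) = trace ((P * A) * (P * A)ᵀ) := by
    rw [transpose_mul, hs, trace_mul_comm (P * A), Matrix.mul_assoc, ← Matrix.mul_assoc P P, hi,
      trace_mul_comm Aᵀ, trace_mul_comm P, trace_mul_comm (P * A), ← Matrix.mul_assoc,
      trace_mul_comm (Aᵀ * P), ← Matrix.mul_assoc, trace_mul_comm]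
  exact h ▸ trace_mul_transpose_self_nonneg _

/-- The best approximation of `A` with columns in the range of `P` is `P * A`. -/
lemma frobNorm_sub_mul_sq_le {m p : ℕ} {P : Matrix (Fin m) (Fin m) ℝ} (hs : Pᵀ = P)
    (hi : P * P = P) (A D : Matrix (Fin m) (Fin p) ℝ) (hD : P * D = D) :
    frobNorm (A - P * A) ^ 2 ≤ frobNorm (A - D) ^ 2 := by
  have h : A - P * A = (A - D) - P * (A - D) := by
    rw [Matrix.mul_sub, hD]; abel
  rw [h, frobNorm_sub_mul_sq hs hi, frobNorm_sq]
  linarith [trace_proj_mul_nonneg hs hi (A - D)]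

/-- Cauchy–Schwarz for the trace pairing with an orthogonal projection. -/
lemma abs_trace_proj_mul_le {m : ℕ} {P : Matrix (Fin m) (Fin m) ℝ} (hs : Pᵀ = P)
    (hi : P * P = P) {r : ℝ} (hr : trace P ≤ r) (E : Matrix (Fin m) (Fin m) ℝ) :
    |trace (P * E)| ≤ √r * frobNorm E := by
  have h₁ : trace (P * E) = ∑ x : Fin m × Fin m, P x.1 x.2 * E x.1 x.2 := by
    rw [Fintype.sum_prod_type]
    conv_lhs => rw [← hs]
    simp only [trace, diag_apply, mul_apply, transpose_apply]
    exact Finset.sum_comm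
  have h₂ : ∑ x : Fin m × Fin m, P x.1 x.2 ^ 2 = trace P := by
    rw [Fintype.sum_prod_type]
    conv_rhs => rw [← hi]
    simp only [trace, diag_apply, mul_apply, sq]
    refine Finset.sum_congr rfl fun i _ => Finset.sum_congr rfl fun j _ => ?_
    rw [← congrFun (congrFun hs i) j, transpose_apply]
  have h₃ : ∑ x : Fin m × Fin m, E x.1 x.2 ^ 2 = frobNorm E ^ 2 := by
    rw [Fintype.sum_prod_type, frobNorm, Real.sq_sqrt (by positivity)]
  have hr₀ : 0 ≤ r := le_trans (h₂ ▸ by positivity) hr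
  refine abs_le_of_sq_le_sq ?_ (by have := frobNorm_nonneg E; positivity)
  rw [mul_pow, Real.sq_sqrt hr₀, h₁]
  refine (Finset.sum_mul_sq_le_sq_mul_sq _ _ _).trans ?_
  rw [h₂, h₃]
  gcongr

/-- The orthogonal projection onto the column space of `D`. -/
lemma exists_proj_of_rank_le {m p k : ℕ} (D : Matrix (Fin m) (Fin p) ℝ) (hD : D.rank ≤ k) :
    ∃ P : Matrix (Fin m) (Fin m) ℝ, Pᵀ = P ∧ P * P = P ∧ P * D = D ∧ trace P ≤ k := by
  let V : Submodule ℝ (EuclideanSpace ℝ (Fin m)) := (toEuclideanLin D).range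
  have hV : Module.finrank ℝ V = D.rank := (rank_eq_finrank_range_toLin D
    (EuclideanSpace.basisFun _ ℝ).toBasis (EuclideanSpace.basisFun _ ℝ).toBasis).symm
  let b := stdOrthonormalBasis ℝ V
  let U : Matrix (Fin m) (Fin (Module.finrank ℝ V)) ℝ := of fun i j => (b j : EuclideanSpace ℝ _) i
  have hU : Uᵀ * U = 1 := by
    ext s t
    have := orthonormal_iff_ite.1 b.orthonormal s t
    rw [Submodule.coe_inner, PiLp.inner_apply] at this
    simp only [RCLike.inner_apply, conj_trivial] at this
    rw [one_apply, ← this, mul_apply]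
    exact Finset.sum_congr rfl fun i _ => mul_comm _ _
  have hUD : U * (Uᵀ * D) = D := by
    ext i j
    let x : V := ⟨toEuclideanLin D (EuclideanSpace.single j 1), LinearMap.mem_range_self _ _⟩
    have hx : ∀ i, (x : EuclideanSpace ℝ (Fin m)) i = D i j := fun i => by
      simp [x, toEuclideanLin, toLpLin_apply]
    have h := congrArg (fun v : V => (v : EuclideanSpace ℝ (Fin m)) i) (b.sum_repr' x)
    simp only [Submodule.coe_sum, Submodule.coe_smul, PiLp.smul_apply, WithLp.ofLp_sum,
      Finset.sum_apply, hx, Submodule.coe_inner, PiLp.inner_apply, smul_eq_mul] at h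
    rw [← h, mul_apply]
    refine Finset.sum_congr rfl fun s _ => ?_
    rw [mul_comm, mul_apply]
    simp [U, mul_comm]
  refine ⟨U * Uᵀ, by simp, ?_, by rw [Matrix.mul_assoc, hUD], ?_⟩
  · rw [Matrix.mul_assoc, ← Matrix.mul_assoc Uᵀ, hU, Matrix.one_mul]
  · rw [trace_mul_comm, hU, trace_one, Fintype.card_fin, hV]
    exact_mod_cast hD

/-- A weighted sum of decreasing values with weights in `[0, 1]` of total mass at most `k` is at
most the sum of the `k` largest values. -/
lemma sum_mul_le_sum_castLE {c k : ℕ} (hk : 0 < k) (hkc : k ≤ c) {a w : Fin c → ℝ}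
    (ha : Antitone a) (ha₀ : ∀ t, 0 ≤ a t) (hw₀ : ∀ t, 0 ≤ w t) (hw₁ : ∀ t, w t ≤ 1)
    (hw : ∑ t, w t ≤ k) : ∑ t, a t * w t ≤ ∑ t : Fin k, a (Fin.castLE hkc t) := by
  obtain ⟨d, rfl⟩ := Nat.exists_eq_add_of_le hkc
  let s := a ⟨k - 1, by omega⟩
  have h₁ : ∑ t : Fin k, a (Fin.castAdd d t) * w (Fin.castAdd d t) ≤
      ∑ t : Fin k, (a (Fin.castAdd d t) - s + s * w (Fin.castAdd d t)) := by
    refine Finset.sum_le_sum fun t _ => ?_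
    have : s ≤ a (Fin.castAdd d t) := ha (by rw [Fin.le_def]; simp; omega)
    nlinarith [hw₁ (Fin.castAdd d t)]
  have h₂ : ∑ t : Fin d, a (Fin.natAdd k t) * w (Fin.natAdd k t) ≤
      ∑ t : Fin d, s * w (Fin.natAdd k t) := by
    refine Finset.sum_le_sum fun t _ => mul_le_mul_of_nonneg_right ?_ (hw₀ _)
    exact ha (by rw [Fin.le_def]; simp; omega)
  rw [Fin.sum_univ_add] at hw ⊢
  rw [Finset.sum_add_distrib, Finset.sum_sub_distrib, ← Finset.mul_sum] at h₁
  rw [← Finset.mul_sum] at h₂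
  simp only [Finset.sum_const, Finset.card_univ, Fintype.card_fin, nsmul_eq_mul] at h₁
  have h₃ := mul_le_mul_of_nonneg_left hw (ha₀ ⟨k - 1, by omega⟩)
  change s * _ ≤ s * _ at h₃
  change _ ≤ ∑ t : Fin k, a (Fin.castAdd d t)
  linarith

/-- Ky Fan's inequality for a matrix `G` with columns that are orthonormal or zero. -/
lemma trace_proj_mul_le_sum {m c k : ℕ} (hk : 0 < k) (hkc : k ≤ c)
    {P : Matrix (Fin m) (Fin m) ℝ} (hs : Pᵀ = P) (hi : P * P = P) (hP : trace P ≤ k)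
    {a e : Fin c → ℝ} (ha : Antitone a) (ha₀ : ∀ t, 0 ≤ a t) {G : Matrix (Fin m) (Fin c) ℝ}
    (he : ∀ t, e t ≤ 1) (hG : Gᵀ * G = diagonal e) (hGe : G * diagonal e = G) :
    trace (P * (G * diagonal a * Gᵀ)) ≤ ∑ t : Fin k, a (Fin.castLE hkc t) := by
  have hs' : (1 - P)ᵀ = 1 - P := by rw [transpose_sub, transpose_one, hs]
  have hi' : (1 - P) * (1 - P) = 1 - P := by
    simp [Matrix.sub_mul, Matrix.mul_sub, hi]
  have hdiag : ∀ {Q : Matrix (Fin m) (Fin m) ℝ}, Qᵀ = Q → Q * Q = Q →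
      ∀ t, 0 ≤ (Gᵀ * Q * G) t t := fun {Q} h₁ h₂ t => by
    have : Gᵀ * Q * G = (Q * G)ᵀ * (Q * G) := by
      rw [transpose_mul, h₁, Matrix.mul_assoc, Matrix.mul_assoc, ← Matrix.mul_assoc Q Q, h₂]
    rw [this, mul_apply]
    exact Finset.sum_nonneg fun i _ => mul_self_nonneg _
  have hGs : (G * Gᵀ)ᵀ = G * Gᵀ := by simp
  have hGi : (G * Gᵀ) * (G * Gᵀ) = G * Gᵀ := by
    rw [← Matrix.mul_assoc, Matrix.mul_assoc G, hG, hGe]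
  have htr : trace (P * (G * diagonal a * Gᵀ)) = ∑ t, a t * (Gᵀ * P * G) t t := by
    rw [← Matrix.mul_assoc, trace_mul_comm, ← Matrix.mul_assoc, ← Matrix.mul_assoc]
    simp [trace, mul_diagonal, mul_comm]
  rw [htr]
  refine sum_mul_le_sum_castLE hk hkc ha ha₀ (hdiag hs hi) (fun t => ?_) ?_
  · have := hdiag hs' hi' t
    rw [Matrix.mul_sub, Matrix.sub_mul, Matrix.mul_one, Matrix.sub_apply, hG, diagonal_apply_eq] at this
    linarith [he t]
  · change trace (Gᵀ * P * G) ≤ k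
    have h := trace_mul_transpose_self_nonneg (P - G * Gᵀ * P)
    rw [← frobNorm_sq, frobNorm_sub_mul_sq hGs hGi, hs, hi] at h
    rw [Matrix.mul_assoc, trace_mul_comm, Matrix.mul_assoc, trace_mul_comm]
    linarith

theorem stmt_16 {m n c k : ℕ} (hm : 0 < m) (hn : 0 < n) (hc : 0 < c) (hk : 0 < k)
    (hkc : k ≤ c)
    (A : Matrix (Fin m) (Fin n) ℝ) (C : Matrix (Fin m) (Fin c) ℝ)
    (y : Fin c → Fin c → ℝ)
    (horth : ∀ s t, (∑ i, y s i * y t i) = if s = t then (1 : ℝ) else 0)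
    (σ : Fin c → ℝ)
    (heig : ∀ t, (Cᵀ * C) *ᵥ y t = (σ t) ^ 2 • y t)
    (hmono : Antitone σ) (hnonneg : ∀ t, 0 ≤ σ t)
    (hpos : ∀ t : Fin c, (t : ℕ) < k → 0 < σ t)
    (H : Matrix (Fin m) (Fin k) ℝ)
    (hH : ∀ (i : Fin m) (t : Fin k),
      H i t = (σ (Fin.castLE hkc t))⁻¹ * (C *ᵥ y (Fin.castLE hkc t)) i) :
    ∀ D : Matrix (Fin m) (Fin n) ℝ, Matrix.rank D ≤ k →
      frobNorm (A - H * Hᵀ * A) ^ 2 ≤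
        frobNorm (A - D) ^ 2 + 2 * Real.sqrt (k : ℝ) * frobNorm (A * Aᵀ - C * Cᵀ) := by
  intro D hD
  let Y : Matrix (Fin c) (Fin c) ℝ := of fun i t => y t i
  let a : Fin c → ℝ := fun t => σ t ^ 2
  let e : Fin c → ℝ := fun t => (σ t)⁻¹ * σ t
  obtain ⟨G, hGY⟩ : ∃ G, G = C * Y * diagonal fun t => (σ t)⁻¹ := ⟨_, rfl⟩
  have hY : Yᵀ * Y = 1 := by
    ext s t
    simpa [Y, mul_apply, one_apply] using horth s t
  have hY' : Y * Yᵀ = 1 := mul_eq_one_comm.1 hY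
  have hCY : (C * Y)ᵀ * (C * Y) = diagonal a := by
    have h : Cᵀ * C * Y = Y * diagonal a := by
      ext i t
      rw [mul_diagonal]
      simpa [mulVec, dotProduct, mul_apply, Y, a, mul_comm] using congrFun (heig t) i
    rw [transpose_mul, Matrix.mul_assoc, ← Matrix.mul_assoc Cᵀ, h, ← Matrix.mul_assoc, hY,
      Matrix.one_mul]
  have hGσ : G * diagonal σ = C * Y := by
    ext i t
    rw [mul_diagonal, hGY, mul_diagonal]
    rcases eq_or_ne (σ t) 0 with h | h
    · have h₀ : ∑ j, (C * Y) j t * (C * Y) j t = 0 := by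
        have := congrFun (congrFun hCY t) t
        rwa [mul_apply, diagonal_apply_eq, show a t = 0 by simp [a, h]] at this
      rw [Finset.sum_eq_zero_iff_of_nonneg fun j _ => mul_self_nonneg _] at h₀
      rw [h, mul_zero, mul_self_eq_zero.1 (h₀ i (Finset.mem_univ i))]
    · field_simp
  have hC : C * Cᵀ = G * diagonal a * Gᵀ := by
    have : diagonal a = diagonal σ * (diagonal σ)ᵀ := by simp [a, sq]
    rw [this, ← Matrix.mul_assoc, Matrix.mul_assoc, ← transpose_mul, hGσ, transpose_mul,
      Matrix.mul_assoc, ← Matrix.mul_assoc Y, hY', Matrix.one_mul]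
  have hG : Gᵀ * G = diagonal e := by
    rw [hGY, transpose_mul, Matrix.mul_assoc, ← Matrix.mul_assoc (C * Y)ᵀ, hCY, diagonal_transpose,
      diagonal_mul_diagonal, diagonal_mul_diagonal]
    congr 1
    ext t
    rcases eq_or_ne (σ t) 0 with h | h
    · simp [a, e, h]
    · simp only [a, e]
      field_simp
  have hGe : G * diagonal e = G := by
    rw [hGY, Matrix.mul_assoc, diagonal_mul_diagonal]
    congr 2
    ext t
    rcases eq_or_ne (σ t) 0 with h | h <;> simp [e, h]
  have he : ∀ t, e t ≤ 1 := fun t => inv_mul_le_one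
  have ha : Antitone a := fun s t h => pow_le_pow_left₀ (hnonneg t) (hmono h) 2
  have hHG : H = G.submatrix id (Fin.castLE hkc) := by
    ext i t
    rw [hH, submatrix_apply, hGY, mul_diagonal, mul_comm]
    rfl
  have he₁ : ∀ t : Fin k, e (Fin.castLE hkc t) = 1 := fun t =>
    inv_mul_cancel₀ (hpos (Fin.castLE hkc t) t.2).ne'
  have hHH : Hᵀ * H = 1 := by
    have : Hᵀ * H = (Gᵀ * G).submatrix (Fin.castLE hkc) (Fin.castLE hkc) := by
      rw [hHG]; rfl
    rw [this, hG, submatrix_diagonal _ _ (Fin.castLE_injective hkc), ← diagonal_one]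
    congr 1
    exact funext he₁
  have hQs : (H * Hᵀ)ᵀ = H * Hᵀ := by simp
  have hQi : H * Hᵀ * (H * Hᵀ) = H * Hᵀ := by
    rw [Matrix.mul_assoc, ← Matrix.mul_assoc Hᵀ, hHH, Matrix.one_mul]
  have hQt : trace (H * Hᵀ) ≤ k := by
    rw [trace_mul_comm, hHH, trace_one, Fintype.card_fin]
  have hQC : trace (H * Hᵀ * (C * Cᵀ)) = ∑ t : Fin k, a (Fin.castLE hkc t) := by
    have h₁ : Gᵀ * (C * Cᵀ) * G = diagonal fun t => e t * a t * e t := by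
      rw [hC, ← Matrix.mul_assoc, ← Matrix.mul_assoc, hG, Matrix.mul_assoc _ Gᵀ, hG,
        diagonal_mul_diagonal, diagonal_mul_diagonal]
    have h₂ : Hᵀ * (C * Cᵀ) * H =
        (Gᵀ * (C * Cᵀ) * G).submatrix (Fin.castLE hkc) (Fin.castLE hkc) := by
      rw [hHG]; rfl
    rw [Matrix.mul_assoc, trace_mul_comm, h₂, h₁]
    simp [trace, he₁]
  obtain ⟨P, hPs, hPi, hPD, hPt⟩ := exists_proj_of_rank_le D hD
  have hfan := trace_proj_mul_le_sum hk hkc hPs hPi hPt ha (fun t => sq_nonneg _) he hG hGe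
  rw [← hC, ← hQC] at hfan
  have hPE := abs_le.1 (abs_trace_proj_mul_le hPs hPi hPt (A * Aᵀ - C * Cᵀ))
  have hQE := abs_le.1 (abs_trace_proj_mul_le hQs hQi hQt (A * Aᵀ - C * Cᵀ))
  rw [Matrix.mul_sub, trace_sub] at hPE hQE
  have hPA := frobNorm_sub_mul_sq_le hPs hPi A D hPD
  rw [frobNorm_sub_mul_sq hPs hPi] at hPA
  rw [frobNorm_sub_mul_sq hQs hQi]
  linarith [hPE.2, hQE.1]
end
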